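/- Let S, T ∈ {-1,0,+1}^d be nonzero sign vectors and let σ ⊆ C_S and τ ⊆ C_T be nonempty sets. Then □_S + S·σ ⊆ □_T + T·τ if and only if T ≤ S and σ ⊆ τ. -/

import Mathlib

open Pointwise

/-- The cube `□_d = [-1,1]^d ⊆ ℝ^d`. -/
def cube (d : ℕ) : Set (Fin d → ℝ) := {x | ∀ i, |x i| ≤ 1}

/-- The face `□_S` of the cube determined by the sign vector `S`. -/
def cubeFace {d : ℕ} (S : Fin d → SignType) : Set (Fin d → ℝ) :=
  {x | (∀ i, |x i| ≤ 1) ∧ ∀ i, S i ≠ 0 → x i = (S i : ℝ)}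

/-- The cone `C_S = {x : x i ≥ 0 for all i, x i = 0 for i ∉ supp S}`. -/
def cone {d : ℕ} (S : Fin d → SignType) : Set (Fin d → ℝ) :=
  {x | (∀ i, 0 ≤ x i) ∧ ∀ i, S i = 0 → x i = 0}

/-- The reflection `S·K` of a set `K ⊆ ℝ^d` into the orthant indicated by `S`. -/
def sdot {d : ℕ} (S : Fin d → SignType) (K : Set (Fin d → ℝ)) : Set (Fin d → ℝ) :=
  (fun x => fun i => (S i : ℝ) * x i) '' K

/-! Statement 14: for nonzero sign vectors `S`, `T` and nonempty `σ ⊆ C_S`, `τ ⊆ C_T`,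
`□_S + S·σ ⊆ □_T + T·τ` iff `T ≤ S` and `σ ⊆ τ`. -/

/-- The order on sign vectors: `T ≤ S` iff `T i = S i` for every `i` in the support of `T`. -/
def SVLe {d : ℕ} (T S : Fin d → SignType) : Prop := ∀ i, T i ≠ 0 → T i = S i

theorem statement14 {d : ℕ} (hd : 1 ≤ d) (S T : Fin d → SignType)
    (hS : S ≠ 0) (hT : T ≠ 0)
    (σ τ : Set (Fin d → ℝ)) (hσsub : σ ⊆ cone S) (hτsub : τ ⊆ cone T)
    (hσ : σ.Nonempty) (hτ : τ.Nonempty) :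
    cubeFace S + sdot S σ ⊆ cubeFace T + sdot T τ ↔ (SVLe T S ∧ σ ⊆ τ) := by
  constructor
  · intro h
    have key : ∀ s ∈ σ, ∃ t ∈ τ, ∀ i, (T i ≠ 0 → T i = S i) ∧ s i = t i := by
      intro s hs
      have hmem : (fun i => (S i : ℝ)) + (fun i => (S i : ℝ) * s i) ∈ cubeFace S + sdot S σ := by
        refine Set.add_mem_add ⟨fun i => ?_, fun i _ => rfl⟩ ⟨s, hs, rfl⟩
        show |(S i : ℝ)| ≤ 1
        generalize S i = p
        cases p <;> simp
      obtain ⟨y, ⟨hy1, hy2⟩, z, ⟨t, ht, rfl⟩, hyz⟩ := h hmem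
      refine ⟨t, ht, fun i => ?_⟩
      have e := congrFun hyz i
      have a1 := hy1 i
      have a2 := hy2 i
      have b1 := (hσsub hs).1 i
      have b2 := (hσsub hs).2 i
      have c1 := (hτsub ht).1 i
      have c2 := (hτsub ht).2 i
      rw [abs_le] at a1
      simp only [Pi.add_apply] at e
      generalize S i = p at *
      generalize T i = q at *
      cases p <;> cases q <;> simp at * <;> first | linarith | (constructor <;> linarith)
    constructor
    · obtain ⟨s, hs⟩ := hσ
      obtain ⟨t, -, h2⟩ := key s hs
      exact fun i => (h2 i).1
    · intro s hs
      obtain ⟨t, ht, h2⟩ := key s hs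
      have : s = t := funext fun i => (h2 i).2
      exact this ▸ ht
  · rintro ⟨hle, hsub⟩ _ ⟨x, ⟨hx1, hx2⟩, _, ⟨s, hs, rfl⟩, rfl⟩
    refine Set.add_mem_add ⟨hx1, fun i hi => ?_⟩ ⟨s, hsub hs, ?_⟩
    · rw [hle i hi]
      exact hx2 i (hle i hi ▸ hi)
    · funext i
      by_cases hi : T i = 0
      · simp [(hτsub (hsub hs)).2 i hi]
      · simp [hle i hi]
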